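/- arXiv:2312.12539 — 8 statements merged into one kernel-verified Lean document; each statement's English description precedes it below -/
import Mathlib

section
/- Let p, q, m be positive integers. The line y = x/m intersects (touches or crosses) the Ford circle of p/q, i.e. the inequality |(1/m)·(p/q) − 1/(2q²)| / √((1/m)² + 1) ≤ 1/(2q²) holds, if and only if p·q ≤ m. -/
/-- The line `y = x / m` touches or crosses the Ford circle of `p / q`
(center `(p/q, 1/(2q^2))`, radius `1/(2q^2)`) if and only if `p * q ≤ m`. -/
theorem line_touches_ford_circle_iff (p q m : ℕ) (hp : 0 < p) (hq : 0 < q) (hm : 0 < m) :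
    |(1 / (m : ℝ)) * ((p : ℝ) / q) - 1 / (2 * q ^ 2)| / Real.sqrt ((1 / (m : ℝ)) ^ 2 + 1)
      ≤ 1 / (2 * (q : ℝ) ^ 2) ↔ p * q ≤ m := by
  have hq' : (0 : ℝ) < q := Nat.cast_pos.mpr hq
  have hm' : (0 : ℝ) < m := Nat.cast_pos.mpr hm
  rw [div_le_iff₀ (by positivity), ← sq_le_sq₀ (abs_nonneg _) (by positivity), sq_abs, mul_pow,
    Real.sq_sqrt (by positivity), ← sub_nonpos]
  have key : ((1 / (m : ℝ)) * ((p : ℝ) / q) - 1 / (2 * q ^ 2)) ^ 2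
      - (1 / (2 * (q : ℝ) ^ 2)) ^ 2 * ((1 / (m : ℝ)) ^ 2 + 1)
      = (4 * (p * q) * (p * q - m) - 1) / (4 * (q : ℝ) ^ 4 * m ^ 2) := by
    field_simp
    ring
  rw [key, div_le_iff₀ (by positivity), zero_mul, sub_nonpos]
  have hpq : 0 < p * q := Nat.mul_pos hp hq
  constructor
  · intro h
    by_contra! hlt
    have h₁ : (1 : ℝ) ≤ p * q := mod_cast hpq
    have h₂ : (m : ℝ) + 1 ≤ p * q := mod_cast hlt
    nlinarith
  · intro h
    have h₁ : (p : ℝ) * q ≤ m := mod_cast h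
    have h₂ : (0 : ℝ) < p * q := mod_cast hpq
    nlinarith
end

section
/- Let (aₖ/bₖ), k = 1, …, N (N ≥ 2), be an increasing sequence of irreducible fractions with aₖ, bₖ positive integers, satisfying the Farey sum: for every three consecutive indices, a_{k+1}/b_{k+1} = (a_k + a_{k+2})/(b_k + b_{k+2}) as rational numbers. If for some index j one has a_{j+1}·b_j − a_j·b_{j+1} = 1, then a_{k+1}·b_k − a_k·b_{k+1} = 1 for every index k; that is, every pair of consecutive fractions in the sequence is adjacent. -/
/-- If the fraction `q / q'` equals the mediant of `p / p'` and `r / r'`, then the cross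
determinants of the two consecutive pairs agree. -/
lemma cross_det_eq_of_eq_mediant {p q r p' q' r' : ℕ} (hp' : 0 < p') (hq' : 0 < q')
    (h : (q : ℚ) / q' = ((p : ℚ) + r) / ((p' : ℚ) + r')) :
    (r : ℤ) * q' - q * r' = q * p' - p * q' := by
  have hq0 : (q' : ℚ) ≠ 0 := by positivity
  have hs0 : (p' : ℚ) + r' ≠ 0 := by positivity
  rw [div_eq_div_iff hq0 hs0] at h
  have hz : (q : ℤ) * (p' + r') = (p + r) * q' := by exact_mod_cast h
  linarith

/-- If an increasing sequence of irreducible fractions `a k / b k`, `k = 0, …, N - 1`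
(`N ≥ 2`), satisfies the Farey sum for every three consecutive terms, and some pair of
consecutive fractions is adjacent (`a (j+1) * b j - a j * b (j+1) = 1`), then every pair
of consecutive fractions is adjacent. -/
theorem all_consecutive_adjacent_of_farey_sum (N : ℕ) (hN : 2 ≤ N) (a b : ℕ → ℕ)
    (hpos : ∀ k < N, 0 < a k ∧ 0 < b k)
    (hcop : ∀ k < N, Nat.Coprime (a k) (b k))
    (hmono : ∀ k, k + 1 < N → (a k : ℚ) / b k < (a (k + 1) : ℚ) / b (k + 1))
    (hfarey : ∀ k, k + 2 < N →
      (a (k + 1) : ℚ) / (b (k + 1)) = ((a k : ℚ) + a (k + 2)) / ((b k : ℚ) + b (k + 2)))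
    (hadj : ∃ j, j + 1 < N ∧ (a (j + 1) : ℤ) * b j - a j * b (j + 1) = 1) :
    ∀ k, k + 1 < N → (a (k + 1) : ℤ) * b k - a k * b (k + 1) = 1 := by
  obtain ⟨j, hj, hdet⟩ := hadj
  have hconst : ∀ k, k + 1 < N →
      (a (k + 1) : ℤ) * b k - a k * b (k + 1) = a 1 * b 0 - a 0 * b 1 := by
    intro k
    induction k with
    | zero => intro _; rfl
    | succ k ih =>
      intro hk
      rw [← ih (by omega)]
      exact cross_det_eq_of_eq_mediant (hpos k (by omega)).2 (hpos (k + 1) (by omega)).2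
        (hfarey k hk)
  intro k hk
  rw [hconst k hk, ← hconst j hj, hdet]
end

section
/- Let m be a positive integer and let x < y be two elements of F_{1/m} such that no element of F_{1/m} lies strictly between x and y (i.e. x and y are consecutive in F_{1/m}). Writing x = a/b and y = c/d in lowest terms with positive denominators, one has c·b − a·d = 1; that is, consecutive fractions of F_{1/m} are adjacent. -/
/-- The set `F_{1/m}` of fractions extracted from Ford circles by the line `y = x/m`:
rationals `x` with `0 ≤ x ≤ 1` whose reduced numerator times reduced denominator
is at most `m`. -/
def fordFracs (m : ℕ) : Set ℚ := {x : ℚ | 0 ≤ x ∧ x ≤ 1 ∧ x.num * x.den ≤ m}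

/-- Reducing a nonnegative fraction does not increase numerator times denominator. -/
theorem Rat.num_mul_den_div_le {p q : ℤ} (hp : 0 ≤ p) (hq : 0 < q) :
    ((p : ℚ) / q).num * ((p : ℚ) / q).den ≤ p * q := by
  obtain ⟨g, hg₁, hg₂⟩ := Rat.exists_eq_mul_div_num_and_eq_mul_div_den p hq.ne'
  set z : ℚ := (p : ℚ) / q
  have hz : 0 ≤ z := div_nonneg (by exact_mod_cast hp) (by exact_mod_cast hq.le)
  have hn : 0 ≤ z.num := Rat.num_nonneg.mpr hz
  have hd : (0 : ℤ) < z.den := by exact_mod_cast z.den_pos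
  have hg : 1 ≤ g := by
    by_contra! h
    nlinarith
  rw [hg₁, hg₂]
  nlinarith [mul_nonneg hn hd.le, mul_le_mul hg hg zero_le_one (by linarith)]

/-- If `a / b < c / d` are nonadjacent fractions in lowest terms, then some integer vector
`(u, v)` lies in the open cone they span, on or below the segment joining `(a, b)` and `(c, d)`. -/
theorem exists_vector_between_of_not_adjacent {a b c d : ℤ} (hab : IsCoprime a b)
    (hcd : IsCoprime c d) (hk : 1 < c * b - a * d) :
    ∃ u v s : ℤ, 1 ≤ s ∧ s ≤ c * b - a * d - 1 ∧ u * b - a * v = 1 ∧ c * v - u * d = s ∧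
      (c * b - a * d) * u = s * a + c ∧ (c * b - a * d) * v = s * b + d := by
  obtain ⟨e, f, hef⟩ := hab
  set k := c * b - a * d with hkdef
  set n := (c * (-e) - f * d) / k with hn
  have hmod := Int.emod_add_mul_ediv (c * (-e) - f * d) k
  have hlt := Int.emod_lt_of_pos (c * (-e) - f * d) (by linarith : 0 < k)
  have hnn := Int.emod_nonneg (c * (-e) - f * d) (by linarith : k ≠ 0)
  rw [← hn] at hmod
  set s := (c * (-e) - f * d) % k
  have hu : k * (f - n * a) = s * a + c := by
    rw [hkdef] at *
    linear_combination c * hef - a * hmod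
  have hv : k * (-e - n * b) = s * b + d := by
    rw [hkdef] at *
    linear_combination d * hef - b * hmod
  refine ⟨f - n * a, -e - n * b, s, ?_, by omega, by linear_combination hef, ?_, hu, hv⟩
  · by_contra! h
    have hs : s = 0 := by omega
    rw [hs] at hu hv
    have hdvd : IsUnit k := hcd.isUnit_of_dvd' ⟨f - n * a, by linarith⟩ ⟨-e - n * b, by linarith⟩
    rcases Int.isUnit_iff.mp hdvd with h | h <;> omega
  · linear_combination -hmod - n * hkdef

/-- Strictly between two nonadjacent fractions there is one bounded, in both numerator and
denominator, by one of the two. -/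
theorem exists_between_le_of_not_adjacent {a b c d : ℤ} (ha : 0 ≤ a) (hb : 0 < b)
    (hc : 0 < c) (hd : 0 < d) (hab : IsCoprime a b) (hcd : IsCoprime c d)
    (hk : 1 < c * b - a * d) :
    ∃ p q : ℤ, 0 ≤ p ∧ 0 < q ∧ a * q < p * b ∧ p * d < c * q ∧
      (p ≤ a ∧ q ≤ b ∨ p ≤ c ∧ q ≤ d) := by
  by_cases h : a < c ∧ d < b
  · obtain ⟨hac, hdb⟩ := h
    have ha' : 0 < a := by
      refine lt_of_le_of_ne ha fun h0 => ?_
      rw [← h0, isCoprime_zero_left, Int.isUnit_iff] at hab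
      omega
    exact ⟨a, b - 1, ha, by omega, by linarith, by nlinarith, Or.inl ⟨le_rfl, by omega⟩⟩
  obtain ⟨u, v, s, hs₁, hs₂, h₁, h₂, hu, hv⟩ :=
    exists_vector_between_of_not_adjacent hab hcd hk
  set k := c * b - a * d with hkdef
  have hk0 : 0 < k := by linarith
  have hu0 : 0 < u := by
    refine pos_of_mul_pos_right (a := k) ?_ hk0.le
    rw [hu]; positivity
  have hv0 : 0 < v := by
    refine pos_of_mul_pos_right (a := k) ?_ hk0.le
    rw [hv]; positivity
  refine ⟨u, v, hu0.le, hv0, by linarith, by linarith, ?_⟩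
  have hcases : (c ≤ a ∧ d ≤ b) ∨ (a ≤ c ∧ b ≤ d) := by
    by_contra! h'
    have hca : c < a ∧ b < d := by grind
    nlinarith [hca.1, hca.2]
  rcases hcases with ⟨h₃, h₄⟩ | ⟨h₃, h₄⟩
  · exact Or.inl ⟨le_of_mul_le_mul_left (by nlinarith) hk0,
      le_of_mul_le_mul_left (by nlinarith) hk0⟩
  · exact Or.inr ⟨le_of_mul_le_mul_left (by nlinarith) hk0,
      le_of_mul_le_mul_left (by nlinarith) hk0⟩

/-- Consecutive fractions of `F_{1/m}` are adjacent: if `x = a/b < y = c/d` are elements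
of `F_{1/m}` (in lowest terms) with no element of `F_{1/m}` strictly between them, then
`c * b - a * d = 1`. -/
theorem consecutive_in_fordFracs_adjacent (m : ℕ) (hm : 0 < m) (x y : ℚ)
    (hx : x ∈ fordFracs m) (hy : y ∈ fordFracs m) (hxy : x < y)
    (hno : ∀ z ∈ fordFracs m, ¬(x < z ∧ z < y)) :
    y.num * x.den - x.num * y.den = 1 := by
  obtain ⟨hx0, hx1, hxm⟩ := hx
  obtain ⟨hy0, hy1, hym⟩ := hy
  have ha : 0 ≤ x.num := Rat.num_nonneg.mpr hx0
  have hb : (0 : ℤ) < x.den := by exact_mod_cast x.den_pos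
  have hc : 0 < y.num := Rat.num_pos.mpr (hx0.trans_lt hxy)
  have hd : (0 : ℤ) < y.den := by exact_mod_cast y.den_pos
  have hlt : x.num * y.den < y.num * x.den := Rat.lt_iff x y |>.mp hxy
  by_contra hne
  obtain ⟨p, q, hp, hq, hxz, hzy, hle⟩ := exists_between_le_of_not_adjacent ha hb hc hd
    (Rat.isCoprime_num_den x) (Rat.isCoprime_num_den y) (by omega)
  have hqQ : (0 : ℚ) < q := by exact_mod_cast hq
  have hxz' : x < (p : ℚ) / q := by
    rw [← Rat.num_div_den x, div_lt_div_iff₀ (by exact_mod_cast hb) hqQ]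
    exact_mod_cast hxz
  have hzy' : (p : ℚ) / q < y := by
    rw [← Rat.num_div_den y, div_lt_div_iff₀ hqQ (by exact_mod_cast hd)]
    exact_mod_cast hzy
  refine hno _ ⟨hx0.trans hxz'.le, hzy'.le.trans hy1, ?_⟩ ⟨hxz', hzy'⟩
  refine (Rat.num_mul_den_div_le hp hq).trans ?_
  rcases hle with ⟨h₁, h₂⟩ | ⟨h₁, h₂⟩
  · exact (mul_le_mul h₁ h₂ hq.le ha).trans hxm
  · exact (mul_le_mul h₁ h₂ hq.le hc.le).trans hym
end

section
/- For every integer m ≥ 2, the jump S_m := |F_{1/m}| − |F_{1/(m−1)}| satisfies S_m = 2^(ω(m) − 1), where ω(m) is the number of distinct prime factors of m. In particular every jump is a power of 2. -/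
/-- The ordered factorizations of `m` into two coprime factors. -/
def coprimeFactorizations (m : ℕ) : Finset (ℕ × ℕ) :=
  {x ∈ m.divisorsAntidiagonal | x.1.Coprime x.2}

theorem mem_coprimeFactorizations {m : ℕ} {x : ℕ × ℕ} :
    x ∈ coprimeFactorizations m ↔ (x.1 * x.2 = m ∧ m ≠ 0) ∧ x.1.Coprime x.2 := by
  simp [coprimeFactorizations]

theorem primeFactors_prod_pow_factorization {m : ℕ} {s : Finset ℕ} (hs : s ⊆ m.primeFactors) :
    (∏ p ∈ s, p ^ m.factorization p).primeFactors = s := by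
  have hne : ∀ p ∈ s, p ^ m.factorization p ≠ 0 := fun p hp =>
    pow_ne_zero _ (Nat.prime_of_mem_primeFactors (hs hp)).ne_zero
  ext q
  rw [Nat.mem_primeFactors_of_ne_zero (Finset.prod_ne_zero_iff.2 hne)]
  constructor
  · rintro ⟨hq, hdvd⟩
    obtain ⟨p, hp, hqp⟩ := (hq.prime.dvd_finsetProd_iff _).1 hdvd
    rwa [(Nat.prime_dvd_prime_iff_eq hq (Nat.prime_of_mem_primeFactors (hs hp))).1
      (hq.dvd_of_dvd_pow hqp)]
  · intro hq
    have hqm := Nat.mem_primeFactors.1 (hs hq)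
    exact ⟨hqm.1, (dvd_pow_self q (hqm.1.factorization_pos_of_dvd hqm.2.2 hqm.2.1).ne').trans
      (Finset.dvd_prod_of_mem (fun p => p ^ m.factorization p) hq)⟩

theorem prod_primeFactors_left_pow_factorization_mul {a b : ℕ} (ha : a ≠ 0)
    (hab : a.Coprime b) :
    ∏ p ∈ a.primeFactors, p ^ (a * b).factorization p = a := by
  conv_rhs => rw [← Nat.prod_factorization_pow_eq_self ha]
  refine Finset.prod_congr rfl fun p hp => ?_
  rw [Nat.factorization_eq_of_coprime_left hab (Nat.mem_primeFactors_iff_mem_primeFactorsList.1 hp)]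

theorem card_coprimeFactorizations {m : ℕ} (hm : m ≠ 0) :
    (coprimeFactorizations m).card = 2 ^ m.primeFactors.card := by
  rw [← Finset.card_powerset]
  refine Finset.card_nbij (fun x => x.1.primeFactors) ?_ ?_ ?_
  · intro x hx
    have hx := mem_coprimeFactorizations.1 hx
    exact Finset.mem_powerset.2 (Nat.primeFactors_mono ⟨x.2, hx.1.1.symm⟩ hm)
  · rintro ⟨a, b⟩ hx ⟨c, d⟩ hy (h : a.primeFactors = c.primeFactors)
    obtain ⟨⟨hab, -⟩, hcop⟩ := mem_coprimeFactorizations.1 hx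
    obtain ⟨⟨hcd, -⟩, hcop'⟩ := mem_coprimeFactorizations.1 hy
    dsimp only at hab hcop hcd hcop'
    have ha : a ≠ 0 := by rintro rfl; simp at hab; exact hm hab.symm
    have hc : c ≠ 0 := by rintro rfl; simp at hcd; exact hm hcd.symm
    have h1 := prod_primeFactors_left_pow_factorization_mul ha hcop
    have h2 := prod_primeFactors_left_pow_factorization_mul hc hcop'
    rw [hab, h] at h1
    rw [hcd, h1] at h2
    subst h2
    rw [Nat.eq_of_mul_eq_mul_left (Nat.pos_of_ne_zero ha) (hab.trans hcd.symm)]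
  · intro s hs
    have hs : s ⊆ m.primeFactors := Finset.mem_powerset.1 hs
    refine ⟨(∏ p ∈ s, p ^ m.factorization p,
      ∏ p ∈ m.primeFactors \ s, p ^ m.factorization p), ?_, primeFactors_prod_pow_factorization hs⟩
    refine mem_coprimeFactorizations.2 ⟨⟨?_, hm⟩, ?_⟩
    · rw [mul_comm, Finset.prod_sdiff hs]
      exact Nat.prod_factorization_pow_eq_self hm
    · refine Nat.Coprime.prod_left fun p hp => Nat.Coprime.prod_right fun q hq => ?_
      refine Nat.Coprime.pow _ _ ((Nat.coprime_primes (Nat.prime_of_mem_primeFactors (hs hp))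
        (Nat.prime_of_mem_primeFactors (Finset.mem_sdiff.1 hq).1)).2 ?_)
      rintro rfl
      exact (Finset.mem_sdiff.1 hq).2 hp

theorem card_coprimeFactorizations_filter_lt {m : ℕ} (hm : 2 ≤ m) :
    {x ∈ coprimeFactorizations m | x.1 < x.2}.card = 2 ^ (m.primeFactors.card - 1) := by
  have hswap : {x ∈ coprimeFactorizations m | ¬ x.1 < x.2}.card =
      {x ∈ coprimeFactorizations m | x.1 < x.2}.card := by
    refine Finset.card_nbij' Prod.swap Prod.swap ?_ ?_ (fun _ _ => rfl) (fun _ _ => rfl)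
    · rintro ⟨a, b⟩ hx
      obtain ⟨hx, hlt⟩ := Finset.mem_filter.1 hx
      obtain ⟨⟨hab, h0⟩, hcop⟩ := mem_coprimeFactorizations.1 hx
      dsimp only at hab hcop hlt
      refine Finset.mem_filter.2
        ⟨mem_coprimeFactorizations.2 ⟨⟨(mul_comm b a).trans hab, h0⟩, hcop.symm⟩, ?_⟩
      refine lt_of_le_of_ne (not_lt.1 hlt) ?_
      rintro (rfl : b = a)
      rw [(Nat.coprime_self b).1 hcop] at hab
      omega
    · rintro ⟨a, b⟩ hx
      obtain ⟨hx, hlt⟩ := Finset.mem_filter.1 hx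
      obtain ⟨⟨hab, h0⟩, hcop⟩ := mem_coprimeFactorizations.1 hx
      exact Finset.mem_filter.2
        ⟨mem_coprimeFactorizations.2 ⟨⟨(mul_comm b a).trans hab, h0⟩, hcop.symm⟩,
          not_lt.2 hlt.le⟩
  have hsum := Finset.card_filter_add_card_filter_not (s := coprimeFactorizations m)
    (fun x => x.1 < x.2)
  have hpos : 0 < m.primeFactors.card := Finset.card_pos.2 (Nat.nonempty_primeFactors.2 hm)
  rw [hswap, card_coprimeFactorizations (by omega), ← Nat.sub_add_cancel hpos, pow_succ] at hsum
  simp only [Nat.succ_eq_add_one, zero_add] at hsum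
  omega

theorem fordFracs_mono {m n : ℕ} (h : m ≤ n) : fordFracs m ⊆ fordFracs n :=
  fun _ ⟨h0, h1, hx⟩ => ⟨h0, h1, hx.trans (by exact_mod_cast h)⟩

theorem finite_fordFracs (m : ℕ) : (fordFracs m).Finite := by
  refine Set.Finite.of_finite_image (f := fun x : ℚ => (x.num, x.den))
    (((Set.finite_Icc (0 : ℤ) m).prod (Set.finite_Icc 0 (m + 1))).subset ?_) ?_
  · rintro _ ⟨x, ⟨h0, -, hx⟩, rfl⟩
    have hnum : 0 ≤ x.num := Rat.num_nonneg.2 h0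
    have hden : (0 : ℤ) < x.den := by exact_mod_cast x.den_pos
    refine ⟨⟨hnum, by dsimp only; nlinarith⟩, Nat.zero_le _, ?_⟩
    rcases hnum.eq_or_lt with h | h
    · have : x = 0 := Rat.num_eq_zero.1 h.symm
      simp [this]
    · zify
      nlinarith
  · rintro x - y - h
    exact Rat.ext (congrArg Prod.fst h) (congrArg Prod.snd h)

theorem fordFracs_diff {m : ℕ} (hm : 2 ≤ m) :
    fordFracs m \ fordFracs (m - 1) =
      (fun x : ℕ × ℕ => (x.1 / x.2 : ℚ)) ''
        ({x ∈ coprimeFactorizations m | x.1 < x.2} : Finset (ℕ × ℕ)) := by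
  ext x
  constructor
  · rintro ⟨⟨h0, h1, hx⟩, hx'⟩
    have hprod : x.num * x.den = m := by
      by_contra hne
      refine hx' ⟨h0, h1, ?_⟩
      omega
    have hnum : (x.num.natAbs : ℤ) = x.num := Int.natAbs_of_nonneg (Rat.num_nonneg.2 h0)
    refine ⟨(x.num.natAbs, x.den), ?_, ?_⟩
    · refine Finset.mem_coe.2 (Finset.mem_filter.2
        ⟨mem_coprimeFactorizations.2 ⟨⟨?_, by omega⟩, x.reduced⟩, ?_⟩)
      · zify
        rwa [← Int.natCast_natAbs, hnum]
      · have hle : x.num ≤ x.den := Rat.num_le_denom_iff.2 h1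
        have hne : x.num.natAbs ≠ x.den := by
          intro h
          have hred := x.reduced
          rw [h, Nat.coprime_self] at hred
          rw [← hnum, h, hred] at hprod
          norm_num at hprod
          omega
        dsimp only
        omega
    · have : ((x.num.natAbs : ℕ) : ℚ) = (x.num : ℚ) := by
        rw [← Int.cast_natCast, hnum]
      dsimp only
      rw [this, Rat.num_div_den]
  · rintro ⟨⟨a, b⟩, hab, rfl⟩
    obtain ⟨hab, hlt⟩ := Finset.mem_filter.1 (Finset.mem_coe.1 hab)
    obtain ⟨⟨hab, h0⟩, hcop⟩ := mem_coprimeFactorizations.1 hab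
    dsimp only at hab hlt hcop ⊢
    have hb : 0 < b := by omega
    have hnum := Rat.num_div_eq_of_coprime (a := a) (b := b) (by exact_mod_cast hb) hcop
    have hden := Rat.den_div_eq_of_coprime (a := a) (b := b) (by exact_mod_cast hb) hcop
    push_cast at hnum hden
    have hprod : (a / b : ℚ).num * (a / b : ℚ).den = m := by
      rw [hnum, hden]
      exact_mod_cast hab
    refine ⟨⟨by positivity, ?_, hprod.le⟩, fun h => ?_⟩
    · rw [div_le_one (by exact_mod_cast hb)]
      exact_mod_cast hlt.le
    · have := h.2.2
      omega

theorem injOn_div_coprimeFactorizations (m : ℕ) :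
    Set.InjOn (fun x : ℕ × ℕ => (x.1 / x.2 : ℚ)) (coprimeFactorizations m) := by
  rintro ⟨a, b⟩ hx ⟨c, d⟩ hy h
  obtain ⟨⟨hab, h0⟩, hcop⟩ := mem_coprimeFactorizations.1 (Finset.mem_coe.1 hx)
  obtain ⟨⟨hcd, -⟩, hcop'⟩ := mem_coprimeFactorizations.1 (Finset.mem_coe.1 hy)
  dsimp only at hab hcop hcd hcop' h
  have hb : 0 < b := Nat.pos_of_ne_zero (by rintro rfl; exact h0 (by simpa using hab.symm))
  have hd : 0 < d := Nat.pos_of_ne_zero (by rintro rfl; exact h0 (by simpa using hcd.symm))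
  obtain ⟨hac, hbd⟩ := Rat.div_int_inj (a := a) (b := b) (c := c) (d := d)
    (by exact_mod_cast hb) (by exact_mod_cast hd) hcop hcop' (by push_cast; exact h)
  exact Prod.ext (by exact_mod_cast hac) (by exact_mod_cast hbd)

/-- For `m ≥ 2`, the jump `S_m = |F_{1/m}| - |F_{1/(m-1)}|` equals `2 ^ (ω(m) - 1)`,
where `ω(m)` is the number of distinct prime factors of `m`; in particular every jump
is a power of `2`. -/
theorem card_jump_eq_two_pow (m : ℕ) (hm : 2 ≤ m) :
    (fordFracs m).ncard - (fordFracs (m - 1)).ncard = 2 ^ (m.primeFactors.card - 1) := by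
  rw [← Set.ncard_sdiff (fordFracs_mono (Nat.sub_le m 1)) (finite_fordFracs _), fordFracs_diff hm,
    Set.InjOn.ncard_image ((injOn_div_coprimeFactorizations m).mono
      (Finset.coe_subset.2 (Finset.filter_subset _ _))),
    Set.ncard_coe_finset, card_coprimeFactorizations_filter_lt hm]
end

section
/- There is a constant K > 0 such that for every integer s ≥ 2, | Σ_{p=1}^{s} φ(p)/p² − ( (6/π²)·(ln s + γ) − A ) | ≤ K·(ln s)/s, where φ is Euler's totient function, γ is the Euler–Mascheroni constant, and A = Σ_{n=1}^{∞} μ(n)·ln(n)/n² (a convergent series, μ being the Möbius function). -/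
open ArithmeticFunction

/-- A real sequence whose terms are dominated by the decrements of a nonnegative function is
summable, and that function bounds its tails. -/
lemma summable_and_abs_sum_sub_tsum_le {f F : ℕ → ℝ} (f_zero : f 0 = 0) (hF : ∀ n, 0 ≤ F n)
    (hf : ∀ n, 1 ≤ n → |f (n + 1)| ≤ F n - F (n + 1)) :
    Summable f ∧ ∀ s, 1 ≤ s → |∑ d ∈ Finset.Ioc 0 s, f d - ∑' d, f d| ≤ F s := by
  have tail (s : ℕ) (hs : 1 ≤ s) (k : ℕ) :
      ∑ i ∈ Finset.range k, |f (i + (s + 1))| ≤ F s - F (s + k) := by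
    induction k with
    | zero => simp
    | succ k ih =>
      rw [Finset.sum_range_succ]
      have := hf (s + k) (by lia)
      rw [show k + (s + 1) = s + k + 1 by ring, show s + (k + 1) = s + k + 1 by ring]
      linarith
  have tail_le (s : ℕ) (hs : 1 ≤ s) (k : ℕ) :
      ∑ i ∈ Finset.range k, |f (i + (s + 1))| ≤ F s :=
    (tail s hs k).trans (by linarith [hF (s + k)])
  have shifted (s : ℕ) (hs : 1 ≤ s) : Summable fun i ↦ |f (i + (s + 1))| :=
    summable_of_sum_range_le (fun _ ↦ abs_nonneg _) (tail_le s hs)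
  have summable : Summable f := (summable_nat_add_iff 2).1 (shifted 1 le_rfl).of_abs
  refine ⟨summable, fun s hs ↦ ?_⟩
  have partial_sum : ∑ d ∈ Finset.Ioc 0 s, f d = ∑ d ∈ Finset.range (s + 1), f d := by
    rw [Finset.sum_range_succ', f_zero, add_zero, Finset.range_eq_Ico,
      Finset.sum_Ico_add' f 0 s 1]
    rfl
  rw [partial_sum, ← summable.sum_add_tsum_nat_add (s + 1), sub_add_cancel_left, abs_neg]
  calc |∑' i, f (i + (s + 1))| ≤ ∑' i, |f (i + (s + 1))| := by
        simpa only [Real.norm_eq_abs] using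
          norm_tsum_le_tsum_norm (f := fun i ↦ f (i + (s + 1))) (shifted s hs)
    _ ≤ F s := (shifted s hs).tsum_le_of_sum_range_le (tail_le s hs)

lemma abs_moebius_cast_le_one (n : ℕ) : |(moebius n : ℝ)| ≤ 1 := by
  exact_mod_cast abs_moebius_le_one (n := n)

lemma abs_sum_moebius_div_sq_sub_tsum_le {s : ℕ} (hs : 1 ≤ s) :
    |∑ d ∈ Finset.Ioc 0 s, (moebius d : ℝ) / d ^ 2 - ∑' d : ℕ, (moebius d : ℝ) / d ^ 2| ≤
      1 / s := by
  refine (summable_and_abs_sum_sub_tsum_le (f := fun d : ℕ ↦ (moebius d : ℝ) / d ^ 2)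
    (F := fun n ↦ 1 / (n : ℝ)) (by simp) (fun n ↦ by positivity) fun n hn ↦ ?_).2 s hs
  have hn' : (1 : ℝ) ≤ n := by exact_mod_cast hn
  push_cast
  rw [abs_div, abs_of_nonneg (by positivity : (0 : ℝ) ≤ (n + 1) ^ 2)]
  calc |(moebius (n + 1) : ℝ)| / ((n : ℝ) + 1) ^ 2 ≤ 1 / ((n : ℝ) + 1) ^ 2 := by
        gcongr; exact abs_moebius_cast_le_one _
    _ ≤ 1 / (n * ((n : ℝ) + 1)) := by gcongr; nlinarith
    _ = 1 / n - 1 / ((n : ℝ) + 1) := by field_simp; ring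

lemma abs_sum_moebius_mul_log_div_sq_sub_tsum_le {s : ℕ} (hs : 1 ≤ s) :
    |∑ d ∈ Finset.Ioc 0 s, (moebius d : ℝ) * Real.log d / d ^ 2 -
        ∑' d : ℕ, (moebius d : ℝ) * Real.log d / d ^ 2| ≤ (Real.log s + 2) / s := by
  refine (summable_and_abs_sum_sub_tsum_le
    (f := fun d : ℕ ↦ (moebius d : ℝ) * Real.log d / d ^ 2)
    (F := fun n ↦ (Real.log n + 2) / n) (by simp)
    (fun n ↦ div_nonneg (by linarith [Real.log_natCast_nonneg n]) (by positivity))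
    fun n hn ↦ ?_).2 s hs
  have hn' : (1 : ℝ) ≤ n := by exact_mod_cast hn
  have log_nonneg : 0 ≤ Real.log ((n : ℝ) + 1) := Real.log_nonneg (by linarith)
  have log_le : Real.log ((n : ℝ) + 1) - Real.log n ≤ 1 / n := by
    rw [← Real.log_div (by positivity) (by positivity)]
    refine (Real.log_le_sub_one_of_pos (by positivity)).trans_eq ?_
    field_simp; ring
  push_cast
  rw [abs_div, abs_mul, abs_of_nonneg (by positivity : (0 : ℝ) ≤ (n + 1) ^ 2),
    abs_of_nonneg log_nonneg]
  calc |(moebius (n + 1) : ℝ)| * Real.log ((n : ℝ) + 1) / ((n : ℝ) + 1) ^ 2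
      ≤ 1 * Real.log ((n : ℝ) + 1) / ((n : ℝ) + 1) ^ 2 := by
        gcongr; exact abs_moebius_cast_le_one _
    _ ≤ Real.log ((n : ℝ) + 1) / (n * ((n : ℝ) + 1)) := by
        rw [one_mul]; gcongr; nlinarith
    _ ≤ (Real.log ((n : ℝ) + 1) - 1 / n + 2) / n
          - (Real.log ((n : ℝ) + 1) + 2) / ((n : ℝ) + 1) := by
        rw [← sub_nonneg]
        have : (Real.log ((n : ℝ) + 1) - 1 / n + 2) / n
            - (Real.log ((n : ℝ) + 1) + 2) / ((n : ℝ) + 1)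
            - Real.log ((n : ℝ) + 1) / (n * ((n : ℝ) + 1))
            = (n - 1) / (n ^ 2 * ((n : ℝ) + 1)) := by
          field_simp; ring
        rw [this]
        exact div_nonneg (by linarith) (by positivity)
    _ ≤ (Real.log n + 2) / n - (Real.log ((n : ℝ) + 1) + 2) / ((n : ℝ) + 1) := by
        gcongr; linarith

lemma tsum_moebius_div_sq : ∑' d : ℕ, (moebius d : ℝ) / d ^ 2 = 6 / Real.pi ^ 2 := by
  have h := LSeries_one_mul_Lseries_moebius (s := 2) (by norm_num)
  rw [LSeries_one_eq_riemannZeta (by norm_num), riemannZeta_two] at h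
  have cast : LSeries (fun n ↦ (moebius n : ℂ)) 2
      = ((∑' d : ℕ, (moebius d : ℝ) / d ^ 2 : ℝ) : ℂ) := by
    rw [LSeries, Complex.ofReal_tsum]
    refine tsum_congr fun n ↦ ?_
    rcases eq_or_ne n 0 with rfl | hn
    · simp
    · rw [LSeries.term_of_ne_zero hn]
      push_cast
      norm_cast
  rw [cast] at h
  have h' : Real.pi ^ 2 / 6 * ∑' d : ℕ, (moebius d : ℝ) / d ^ 2 = 1 := by exact_mod_cast h
  have := Real.pi_pos
  rw [eq_div_iff (by positivity)]
  linarith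

lemma sum_totient_div_sq_eq_sum_moebius_mul_harmonic (s : ℕ) :
    ∑ p ∈ Finset.Icc 1 s, (Nat.totient p : ℝ) / p ^ 2 =
      ∑ d ∈ Finset.Ioc 0 s, (moebius d : ℝ) / d ^ 2 * harmonic (s / d) := by
  have totient_eq := (sum_eq_iff_sum_mul_moebius_eq (R := ℝ)
    (f := fun n ↦ (Nat.totient n : ℝ)) (g := fun n ↦ (n : ℝ))).1
    fun n _ ↦ by exact_mod_cast Nat.sum_totient n
  let f : ArithmeticFunction ℝ := ⟨fun n ↦ (moebius n : ℝ) / n ^ 2, by simp⟩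
  let g : ArithmeticFunction ℝ := ⟨fun n ↦ (n : ℝ)⁻¹, by simp⟩
  have convolution_sum := sum_Ioc_mul_eq_sum_sum f g s
  simp only [ArithmeticFunction.mul_apply] at convolution_sum
  calc ∑ p ∈ Finset.Icc 1 s, (Nat.totient p : ℝ) / p ^ 2
      = ∑ p ∈ Finset.Ioc 0 s, ∑ x ∈ p.divisorsAntidiagonal,
          (moebius x.1 : ℝ) / (x.1 : ℝ) ^ 2 * (x.2 : ℝ)⁻¹ := by
        refine Finset.sum_congr rfl fun p hp ↦ ?_
        rw [← totient_eq p (Finset.mem_Icc.1 hp).1, Finset.sum_div]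
        refine Finset.sum_congr rfl fun x hx ↦ ?_
        obtain ⟨rfl, hne⟩ := Nat.mem_divisorsAntidiagonal.1 hx
        have h₁ : (x.1 : ℝ) ≠ 0 := by exact_mod_cast left_ne_zero_of_mul hne
        have h₂ : (x.2 : ℝ) ≠ 0 := by exact_mod_cast right_ne_zero_of_mul hne
        push_cast
        field_simp
    _ = ∑ d ∈ Finset.Ioc 0 s, (moebius d : ℝ) / d ^ 2 *
          ∑ k ∈ Finset.Ioc 0 (s / d), (k : ℝ)⁻¹ := convolution_sum
    _ = _ := by
        refine Finset.sum_congr rfl fun d _ ↦ ?_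
        rw [harmonic_eq_sum_Icc]
        push_cast
        rfl

lemma abs_harmonic_div_sub_le {s d : ℕ} (hd : 1 ≤ d) (hds : d ≤ s) :
    |(harmonic (s / d) : ℝ) - (Real.log s + Real.eulerMascheroniConstant - Real.log d)| ≤
      2 * d / s := by
  set m := s / d with hm
  have m_pos : 1 ≤ m := (Nat.one_le_div_iff hd).2 hds
  have m_pos' : (1 : ℝ) ≤ m := by exact_mod_cast m_pos
  have d_pos : (0 : ℝ) < d := by exact_mod_cast hd
  have s_pos : (0 : ℝ) < s := by exact_mod_cast hd.trans hds
  have lower : (m : ℝ) ≤ s / d := Nat.cast_div_le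
  have upper : (s : ℝ) / d ≤ m + 1 := by
    rw [div_le_iff₀ d_pos]
    exact_mod_cast (Nat.lt_mul_of_div_lt (Nat.lt_succ_self m) hd).le
  have log_lower := Real.log_le_log (by positivity) lower
  have log_upper := Real.log_le_log (by positivity) upper
  rw [Real.log_div s_pos.ne' d_pos.ne'] at log_lower log_upper
  have gamma_lower := Real.eulerMascheroniSeq_lt_eulerMascheroniConstant m
  have gamma_upper := Real.eulerMascheroniConstant_lt_eulerMascheroniSeq' m
  rw [Real.eulerMascheroniSeq] at gamma_lower
  rw [Real.eulerMascheroniSeq', if_neg (by lia)] at gamma_upper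
  have log_gap : Real.log ((m : ℝ) + 1) - Real.log m ≤ 1 / m := by
    rw [← Real.log_div (by positivity) (by positivity)]
    refine (Real.log_le_sub_one_of_pos (by positivity)).trans_eq ?_
    field_simp; ring
  have inv_le : 1 / (m : ℝ) ≤ 2 * d / s := by
    rw [div_le_div_iff₀ (by positivity) s_pos]
    rw [div_le_iff₀ d_pos] at upper
    nlinarith
  rw [abs_le]
  constructor <;> linarith

/-- There is a constant `K > 0` such that for every integer `s ≥ 2`,
`|∑_{p=1}^{s} φ(p)/p² - ((6/π²) (ln s + γ) - A)| ≤ K (ln s)/s`, where `φ` is Euler's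
totient function, `γ` the Euler–Mascheroni constant, and `A = ∑_{n≥1} μ(n) ln(n)/n²`. -/
theorem sum_totient_div_sq_asymptotic :
    ∃ K : ℝ, 0 < K ∧ ∀ s : ℕ, 2 ≤ s →
      |(∑ p ∈ Finset.Icc 1 s, (Nat.totient p : ℝ) / p ^ 2) -
          ((6 / Real.pi ^ 2) * (Real.log s + Real.eulerMascheroniConstant) -
            ∑' n : ℕ, (moebius n : ℝ) * Real.log n / n ^ 2)| ≤
        K * Real.log s / s := by
  refine ⟨14, by norm_num, fun s hs ↦ ?_⟩
  have s_pos : (0 : ℝ) < s := by positivity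
  have log_ge : 1 / 2 ≤ Real.log s :=
    (by linarith [Real.log_two_gt_d9] : 1 / 2 ≤ Real.log 2).trans
      (Real.log_le_log (by norm_num) (by exact_mod_cast hs))
  have gamma_lower := Real.one_half_lt_eulerMascheroniConstant
  have gamma_upper := Real.eulerMascheroniConstant_lt_two_thirds
  have moebius_tail := abs_sum_moebius_div_sq_sub_tsum_le (s := s) (by lia)
  have log_tail := abs_sum_moebius_mul_log_div_sq_sub_tsum_le (s := s) (by lia)
  rw [tsum_moebius_div_sq] at moebius_tail
  rw [sum_totient_div_sq_eq_sum_moebius_mul_harmonic]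
  set γ := Real.eulerMascheroniConstant
  set A := ∑' n : ℕ, (moebius n : ℝ) * Real.log n / n ^ 2
  have harmonic_error : |∑ d ∈ Finset.Ioc 0 s, (moebius d : ℝ) / d ^ 2 *
      (harmonic (s / d) - (Real.log s + γ - Real.log d))| ≤ 2 * (1 + Real.log s) / s := by
    calc _ ≤ ∑ d ∈ Finset.Ioc 0 s, |(moebius d : ℝ) / d ^ 2 *
          (harmonic (s / d) - (Real.log s + γ - Real.log d))| := Finset.abs_sum_le_sum_abs _ _
      _ ≤ ∑ d ∈ Finset.Ioc 0 s, 2 / s * (d : ℝ)⁻¹ := by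
          refine Finset.sum_le_sum fun d hd ↦ ?_
          obtain ⟨hd, hds⟩ := Finset.mem_Ioc.1 hd
          have d_pos : (0 : ℝ) < d := by exact_mod_cast hd
          rw [abs_mul, abs_div, abs_of_nonneg (by positivity : (0 : ℝ) ≤ d ^ 2)]
          calc _ ≤ 1 / (d : ℝ) ^ 2 * (2 * d / s) := by
                gcongr
                · exact abs_moebius_cast_le_one d
                · exact abs_harmonic_div_sub_le hd hds
            _ = _ := by field_simp
      _ = 2 / s * harmonic s := by
          rw [← Finset.mul_sum, harmonic_eq_sum_Icc]
          push_cast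
          rfl
      _ ≤ 2 / s * (1 + Real.log s) := by gcongr; exact harmonic_le_one_add_log s
      _ = _ := by ring
  have decomposition : ∑ d ∈ Finset.Ioc 0 s, (moebius d : ℝ) / d ^ 2 * harmonic (s / d) -
      (6 / Real.pi ^ 2 * (Real.log s + γ) - A) =
      ∑ d ∈ Finset.Ioc 0 s, (moebius d : ℝ) / d ^ 2 *
          (harmonic (s / d) - (Real.log s + γ - Real.log d)) +
        (Real.log s + γ) * (∑ d ∈ Finset.Ioc 0 s, (moebius d : ℝ) / d ^ 2 - 6 / Real.pi ^ 2) -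
        (∑ d ∈ Finset.Ioc 0 s, (moebius d : ℝ) * Real.log d / d ^ 2 - A) := by
    have : ∑ d ∈ Finset.Ioc 0 s, (moebius d : ℝ) / d ^ 2 *
          (harmonic (s / d) - (Real.log s + γ - Real.log d)) =
        ∑ d ∈ Finset.Ioc 0 s, (moebius d : ℝ) / d ^ 2 * harmonic (s / d) -
          (Real.log s + γ) * ∑ d ∈ Finset.Ioc 0 s, (moebius d : ℝ) / d ^ 2 +
          ∑ d ∈ Finset.Ioc 0 s, (moebius d : ℝ) * Real.log d / d ^ 2 := by
      rw [Finset.mul_sum, ← Finset.sum_sub_distrib, ← Finset.sum_add_distrib]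
      exact Finset.sum_congr rfl fun d _ ↦ by ring
    rw [this]
    ring
  rw [decomposition]
  calc _ ≤ 2 * (1 + Real.log s) / s + (Real.log s + γ) * (1 / s) + (Real.log s + 2) / s := by
        refine (abs_sub _ _).trans (add_le_add ((abs_add_le _ _).trans
          (add_le_add harmonic_error ?_)) log_tail)
        rw [abs_mul, abs_of_nonneg (by linarith)]
        gcongr
    _ = (4 * Real.log s + γ + 4) / s := by ring
    _ ≤ 14 * Real.log s / s := by gcongr; linarith
end

section
/- There is a constant K > 0 such that for every integer m ≥ 2, the number of lattice points (p, q) ∈ ℤ × ℤ with 1 ≤ p ≤ q and p·q ≤ m satisfies | #{(p,q) : 1 ≤ p ≤ q, pq ≤ m} − ( (m/2)·ln m + γ·m − m/2 ) | ≤ K·√m, where γ is the Euler–Mascheroni constant. -/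
open Finset in
lemma ncard_lattice_points_under_hyperbola (m : ℕ) :
    {pq : ℕ × ℕ | 1 ≤ pq.1 ∧ pq.1 ≤ pq.2 ∧ pq.1 * pq.2 ≤ m}.ncard =
      ∑ p ∈ Icc 1 m.sqrt, (m / p + 1 - p) := by
  have h : {pq : ℕ × ℕ | 1 ≤ pq.1 ∧ pq.1 ≤ pq.2 ∧ pq.1 * pq.2 ≤ m} =
      Equiv.sigmaEquivProd ℕ ℕ '' ((Icc 1 m.sqrt).sigma fun p => Icc p (m / p) : Finset _) := by
    rw [Equiv.image_eq_preimage_symm]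
    ext ⟨p, q⟩
    simp only [Set.mem_ofPred_eq, Set.mem_preimage, mem_coe, mem_sigma, mem_Icc,
      Equiv.sigmaEquivProd_symm_apply]
    constructor
    · rintro ⟨hp, hpq, hm⟩
      refine ⟨⟨hp, Nat.le_sqrt.2 ?_⟩, hpq, (Nat.le_div_iff_mul_le hp).2 ?_⟩ <;> nlinarith
    · rintro ⟨⟨hp, -⟩, hpq, hm⟩
      exact ⟨hp, hpq, by rw [mul_comm]; exact (Nat.le_div_iff_mul_le hp).1 hm⟩
  rw [h, Set.ncard_image_of_injective _ (Equiv.injective _), Set.ncard_coe_finset, card_sigma]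
  simp

open Finset in
/-- The count of lattice points, approximated by a harmonic number up to `√m`. -/
lemma sum_div_add_one_sub_mem_Icc (m : ℕ) :
    ((∑ p ∈ Icc 1 m.sqrt, (m / p + 1 - p) : ℕ) : ℝ) ∈
      Set.Icc (m * (harmonic m.sqrt : ℝ) - m.sqrt * (m.sqrt + 1) / 2)
        (m * (harmonic m.sqrt : ℝ) - m.sqrt * (m.sqrt + 1) / 2 + m.sqrt) := by
  have hsum (n : ℕ) : ∑ p ∈ Icc 1 n, ((m : ℝ) * (p : ℝ)⁻¹ - p) =
      m * (harmonic n : ℝ) - n * (n + 1) / 2 := by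
    rw [sum_sub_distrib, ← mul_sum, harmonic_eq_sum_Icc]
    congr 1
    · push_cast; rfl
    · induction n with
      | zero => simp
      | succ k ih => rw [sum_Icc_succ_top (by lia), ih]; push_cast; ring
  have hterm : ∀ p ∈ Icc 1 m.sqrt, (m : ℝ) * (p : ℝ)⁻¹ - p ≤ ((m / p + 1 - p : ℕ) : ℝ) ∧
      ((m / p + 1 - p : ℕ) : ℝ) ≤ (m : ℝ) * (p : ℝ)⁻¹ - p + 1 := by
    intro p hp
    obtain ⟨hp1, hps⟩ := mem_Icc.1 hp
    have hle : p ≤ m / p := (Nat.le_div_iff_mul_le hp1).2 (Nat.le_sqrt.1 hps)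
    rw [Nat.cast_sub (by lia), ← div_eq_mul_inv]
    push_cast
    have h1 : ((m / p : ℕ) : ℝ) ≤ (m : ℝ) / p := Nat.cast_div_le
    have h2 : (m : ℝ) / p < (m / p : ℕ) + 1 := by
      rw [← Nat.floor_div_eq_div (K := ℝ)]
      exact Nat.lt_floor_add_one _
    constructor <;> linarith
  rw [← hsum, Nat.cast_sum]
  refine ⟨sum_le_sum fun p hp => (hterm p hp).1,
    (sum_le_sum fun p hp => (hterm p hp).2).trans_eq ?_⟩
  rw [sum_add_distrib]
  simp

/-- There is a constant `K > 0` such that for every integer `m ≥ 2`, the number of lattice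
points `(p, q)` with `1 ≤ p ≤ q` and `p q ≤ m` satisfies
`|#{(p,q)} - ((m/2) ln m + γ m - m/2)| ≤ K √m`, where `γ` is the Euler–Mascheroni
constant. -/
theorem card_lattice_points_under_hyperbola :
    ∃ K : ℝ, 0 < K ∧ ∀ m : ℕ, 2 ≤ m →
      |({pq : ℕ × ℕ | 1 ≤ pq.1 ∧ pq.1 ≤ pq.2 ∧ pq.1 * pq.2 ≤ m}.ncard : ℝ) -
          ((m / 2) * Real.log m + Real.eulerMascheroniConstant * m - m / 2)| ≤
        K * Real.sqrt m := by
  refine ⟨4, by norm_num, fun m hm => ?_⟩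
  rw [ncard_lattice_points_under_hyperbola]
  obtain ⟨hlo, hhi⟩ := sum_div_add_one_sub_mem_Icc m
  have hn : 1 ≤ m.sqrt := Nat.le_sqrt.2 (by lia)
  have hγ₁ := Real.eulerMascheroniSeq_lt_eulerMascheroniConstant m.sqrt
  have hγ₂ := Real.eulerMascheroniConstant_lt_eulerMascheroniSeq' m.sqrt
  rw [Real.eulerMascheroniSeq] at hγ₁
  rw [Real.eulerMascheroniSeq', if_neg (by lia)] at hγ₂
  have hns : (m.sqrt : ℝ) ≤ √m := Real.nat_sqrt_le_real_sqrt
  have hsn : √(m : ℝ) ≤ m.sqrt + 1 := Real.real_sqrt_le_nat_sqrt_succ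
  have hs : √(m : ℝ) * √m = m := Real.mul_self_sqrt (by positivity)
  have hlog : Real.log √m = Real.log m / 2 := Real.log_sqrt (by positivity)
  generalize ((∑ p ∈ Finset.Icc 1 m.sqrt, (m / p + 1 - p) : ℕ) : ℝ) = C at *
  generalize (harmonic m.sqrt : ℝ) = H at *
  have hn' : (1 : ℝ) ≤ m.sqrt := by exact_mod_cast hn
  generalize (m.sqrt : ℝ) = n at *
  generalize √(m : ℝ) = s at *
  generalize (m : ℝ) = x at *
  generalize Real.eulerMascheroniConstant = γ at *
  have hl₁ : Real.log n ≤ Real.log s := Real.log_le_log (by linarith) hns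
  have hl₂ : Real.log s ≤ Real.log (n + 1) := Real.log_le_log (by linarith) hsn
  have hl₃ : Real.log (n + 1) - Real.log n ≤ 1 / n := by
    rw [← Real.log_div (by linarith) (by linarith)]
    refine (Real.log_le_sub_one_of_pos (by positivity)).trans_eq ?_
    field_simp
    ring
  have hx : 0 ≤ x := by nlinarith
  have hxn : x * (1 / n) ≤ 2 * s := by
    rw [mul_one_div, div_le_iff₀ (by linarith)]
    nlinarith
  have hH₁ : x * (Real.log s + γ - 1 / n) ≤ x * H :=
    mul_le_mul_of_nonneg_left (by linarith) hx
  have hH₂ : x * H ≤ x * (Real.log s + γ + 1 / n) :=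
    mul_le_mul_of_nonneg_left (by linarith) hx
  rw [hlog] at hH₁ hH₂
  have hnx : n * n ≤ x := by nlinarith
  have hxn' : x ≤ n * n + 2 * n + 1 := by nlinarith
  rw [abs_le]
  constructor <;> nlinarith
end

section
/- There is a constant K > 0 such that for every integer m ≥ 2, | |F_{1/m}| − (3/π²)·m·ln m | ≤ K·m; that is, the cardinality of F_{1/m} grows log-linearly, with |F_{1/m}| = (m/(2ζ(2)))·ln m + O(m). -/
section

open Finset ArithmeticFunction
open scoped ArithmeticFunction.Moebius

/-- The pairs of positive integers with product at most `n`. -/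
def hyperbolaPairs (n : ℕ) : Finset (ℕ × ℕ) :=
  (Icc 1 n ×ˢ Icc 1 n).filter fun x => x.1 * x.2 ≤ n

theorem mem_hyperbolaPairs {n : ℕ} {x : ℕ × ℕ} :
    x ∈ hyperbolaPairs n ↔ 0 < x.1 ∧ 0 < x.2 ∧ x.1 * x.2 ≤ n := by
  simp only [hyperbolaPairs, mem_filter, mem_product, mem_Icc]
  constructor
  · rintro ⟨⟨⟨h1, _⟩, h2, _⟩, h⟩
    exact ⟨h1, h2, h⟩
  · rintro ⟨h1, h2, h⟩
    exact ⟨⟨⟨h1, by nlinarith⟩, h2, by nlinarith⟩, h⟩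

/-- The coprime pairs of positive integers with product at most `n`. -/
def coprimeHyperbolaPairs (n : ℕ) : Finset (ℕ × ℕ) :=
  (hyperbolaPairs n).filter fun x => Nat.Coprime x.1 x.2

theorem card_hyperbolaPairs (n : ℕ) : #(hyperbolaPairs n) = ∑ k ∈ Icc 1 n, n / k := by
  rw [hyperbolaPairs, card_filter, sum_product]
  refine sum_congr rfl fun k hk => ?_
  have hk0 : 0 < k := (mem_Icc.1 hk).1
  rw [← card_filter]
  have : {b ∈ Icc 1 n | k * b ≤ n} = Icc 1 (n / k) := by
    ext b
    simp only [mem_filter, mem_Icc, Nat.le_div_iff_mul_le hk0, mul_comm b k]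
    exact ⟨fun h => ⟨h.1.1, h.2⟩, fun h => ⟨⟨h.1, by nlinarith⟩, h.2⟩⟩
  simp [this]

theorem card_hyperbolaPairs_le (n : ℕ) (hn : 1 ≤ n) :
    (#(hyperbolaPairs n) : ℝ) ≤ n * (1 + Real.log n) := by
  have h : (#(hyperbolaPairs n) : ℝ) ≤ n * (harmonic n : ℝ) := by
    rw [card_hyperbolaPairs, harmonic_eq_sum_Icc]
    push_cast
    rw [mul_sum]
    exact sum_le_sum fun k _ => by simpa [div_eq_mul_inv] using (Nat.cast_div_le (α := ℝ) (m := n) (n := k))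
  exact h.trans (mul_le_mul_of_nonneg_left (harmonic_le_one_add_log n) (by positivity))

theorem le_card_hyperbolaPairs (n : ℕ) :
    n * Real.log (n + 1 : ℕ) - n ≤ (#(hyperbolaPairs n) : ℝ) := by
  have h : n * (harmonic n : ℝ) - n ≤ (#(hyperbolaPairs n) : ℝ) := by
    have h1 : n * (harmonic n : ℝ) - n = ∑ k ∈ Icc 1 n, ((n : ℝ) / k - 1) := by
      rw [harmonic_eq_sum_Icc, sum_sub_distrib]
      push_cast
      simp [mul_sum, div_eq_mul_inv]
    rw [h1, card_hyperbolaPairs]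
    push_cast
    refine sum_le_sum fun k _ => ?_
    have := Nat.lt_floor_add_one ((n : ℝ) / k)
    rw [Nat.floor_div_eq_div] at this
    linarith
  have := mul_le_mul_of_nonneg_left (log_add_one_le_harmonic n) (Nat.cast_nonneg (α := ℝ) n)
  linarith

theorem abs_card_hyperbolaPairs_floor_sub_le {x : ℝ} (hx : 1 ≤ x) :
    |(#(hyperbolaPairs ⌊x⌋₊) : ℝ) - x * Real.log x| ≤ 2 * x := by
  have hn : 1 ≤ ⌊x⌋₊ := (Nat.one_le_floor_iff x).2 hx
  have hn' : (1 : ℝ) ≤ ⌊x⌋₊ := by exact_mod_cast hn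
  have hfl := Nat.floor_le (zero_le_one.trans hx)
  have hfl' := Nat.lt_floor_add_one x
  have hlog := Real.log_nonneg hx
  have hlog' := Real.log_le_sub_one_of_pos (zero_lt_one.trans_le hx)
  have hu := card_hyperbolaPairs_le _ hn
  have hl := le_card_hyperbolaPairs ⌊x⌋₊
  have h1 : Real.log ⌊x⌋₊ ≤ Real.log x := Real.log_le_log (by linarith) hfl
  have h2 : Real.log x ≤ Real.log (⌊x⌋₊ + 1 : ℕ) :=
    Real.log_le_log (by linarith) (by push_cast; exact hfl'.le)
  have h3 := Real.log_nonneg hn'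
  rw [abs_le]
  constructor <;> nlinarith

theorem card_filter_dvd_hyperbolaPairs (n : ℕ) {d : ℕ} (hd : 0 < d) :
    #{x ∈ hyperbolaPairs n | d ∣ x.1 ∧ d ∣ x.2} = #(hyperbolaPairs (n / d ^ 2)) := by
  symm
  refine card_bij (fun x _ => (d * x.1, d * x.2)) ?_ ?_ ?_
  · intro x hx
    rw [mem_hyperbolaPairs, Nat.le_div_iff_mul_le (by positivity)] at hx
    simp only [mem_filter, mem_hyperbolaPairs, dvd_mul_right, and_true]
    exact ⟨Nat.mul_pos hd hx.1, Nat.mul_pos hd hx.2.1, by linarith [hx.2.2]⟩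
  · rintro ⟨a, b⟩ _ ⟨a', b'⟩ _ h
    simpa [hd.ne'] using h
  · rintro ⟨a, b⟩ h
    simp only [mem_filter, mem_hyperbolaPairs] at h
    obtain ⟨⟨ha, hb, hab⟩, ⟨a, rfl⟩, ⟨b, rfl⟩⟩ := h
    refine ⟨(a, b), ?_, rfl⟩
    rw [mem_hyperbolaPairs, Nat.le_div_iff_mul_le (by positivity)]
    exact ⟨Nat.pos_of_mul_pos_left ha, Nat.pos_of_mul_pos_left hb, by linarith⟩

theorem sum_divisors_moebius {n : ℕ} : ∑ d ∈ n.divisors, μ d = if n = 1 then 1 else 0 := by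
  rw [← coe_mul_zeta_apply, moebius_mul_coe_zeta, one_apply]

theorem card_coprimeHyperbolaPairs (m : ℕ) :
    (#(coprimeHyperbolaPairs m) : ℤ) = ∑ d ∈ Icc 1 m, μ d * #(hyperbolaPairs (m / d ^ 2)) := by
  have h : ∀ d ∈ Icc 1 m, μ d * (#(hyperbolaPairs (m / d ^ 2)) : ℤ) =
      ∑ x ∈ hyperbolaPairs m, if d ∣ x.1 ∧ d ∣ x.2 then μ d else 0 := by
    intro d hd
    rw [← card_filter_dvd_hyperbolaPairs m (mem_Icc.1 hd).1, ← sum_filter, sum_const,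
      nsmul_eq_mul, mul_comm]
  rw [sum_congr rfl h, sum_comm, coprimeHyperbolaPairs, card_filter]
  push_cast
  refine sum_congr rfl fun x hx => ?_
  rw [mem_hyperbolaPairs] at hx
  rw [← sum_filter]
  have : {d ∈ Icc 1 m | d ∣ x.1 ∧ d ∣ x.2} = (Nat.gcd x.1 x.2).divisors := by
    ext d
    simp only [mem_filter, mem_Icc, Nat.mem_divisors, Nat.dvd_gcd_iff]
    constructor
    · rintro ⟨_, h⟩
      exact ⟨h, (Nat.gcd_pos_of_pos_left _ hx.1).ne'⟩
    · rintro ⟨h, _⟩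
      have := Nat.le_of_dvd hx.1 h.1
      exact ⟨⟨Nat.pos_of_dvd_of_pos h.1 hx.1, by nlinarith⟩, h⟩
  rw [this, sum_divisors_moebius]

theorem card_coprimeHyperbolaPairs_add_one {m : ℕ} (hm : 1 ≤ m) :
    #(coprimeHyperbolaPairs m) + 1 = 2 * #{x ∈ coprimeHyperbolaPairs m | x.1 ≤ x.2} := by
  have hswap : #{x ∈ coprimeHyperbolaPairs m | x.2 ≤ x.1} =
      #{x ∈ coprimeHyperbolaPairs m | x.1 ≤ x.2} := by
    refine card_bij' (fun x _ => x.swap) (fun x _ => x.swap) ?_ ?_ ?_ ?_ <;>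
    simp +contextual [coprimeHyperbolaPairs, mem_hyperbolaPairs, mul_comm] <;>
    exact fun _ _ _ _ _ h _ => h.symm
  have hunion : {x ∈ coprimeHyperbolaPairs m | x.1 ≤ x.2} ∪
      {x ∈ coprimeHyperbolaPairs m | x.2 ≤ x.1} = coprimeHyperbolaPairs m := by
    rw [← filter_or]
    exact filter_true_of_mem fun x _ => le_total _ _
  have hinter : {x ∈ coprimeHyperbolaPairs m | x.1 ≤ x.2} ∩
      {x ∈ coprimeHyperbolaPairs m | x.2 ≤ x.1} = {(1, 1)} := by
    rw [← filter_and]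
    ext ⟨a, b⟩
    simp only [coprimeHyperbolaPairs, mem_filter, mem_hyperbolaPairs, mem_singleton, Prod.mk.injEq]
    constructor
    · rintro ⟨⟨_, h⟩, h1, h2⟩
      obtain rfl := le_antisymm h1 h2
      simpa using h
    · rintro ⟨rfl, rfl⟩
      simpa using hm
  have := card_union_add_card_inter {x ∈ coprimeHyperbolaPairs m | x.1 ≤ x.2}
    {x ∈ coprimeHyperbolaPairs m | x.2 ≤ x.1}
  rw [hunion, hinter, card_singleton, hswap] at this
  omega

theorem ncard_fordFracs (m : ℕ) :
    (fordFracs m).ncard = #{x ∈ coprimeHyperbolaPairs m | x.1 ≤ x.2} + 1 := by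
  have hinj : Set.InjOn (fun x : ℕ × ℕ => (x.1 / x.2 : ℚ))
      ({x ∈ coprimeHyperbolaPairs m | x.1 ≤ x.2} : Finset (ℕ × ℕ)) := by
    rintro ⟨a, b⟩ h ⟨a', b'⟩ h' heq
    simp only [coprimeHyperbolaPairs, coe_filter, mem_filter, mem_hyperbolaPairs,
      Set.mem_ofPred_eq] at h h'
    have := Rat.div_int_inj (a := a) (b := b) (c := a') (d := b') (by exact_mod_cast h.1.1.2.1)
      (by exact_mod_cast h'.1.1.2.1) h.1.2 h'.1.2 (by simpa using heq)
    exact Prod.ext (by exact_mod_cast this.1) (by exact_mod_cast this.2)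
  have hset : fordFracs m = ↑(insert (0 : ℚ)
      ({x ∈ coprimeHyperbolaPairs m | x.1 ≤ x.2}.image fun x : ℕ × ℕ => (x.1 / x.2 : ℚ))) := by
    ext x
    simp only [fordFracs, Set.mem_ofPred_eq, coe_insert, coe_image, Set.mem_insert_iff,
      Set.mem_image, mem_coe, coprimeHyperbolaPairs, mem_filter, mem_hyperbolaPairs]
    constructor
    · rintro ⟨h0, h1, h⟩
      rcases h0.eq_or_lt with rfl | hpos
      · exact Or.inl rfl
      right
      have hn := Rat.num_pos.2 hpos
      have hnum : (x.num.toNat : ℤ) = x.num := Int.toNat_of_nonneg hn.le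
      refine ⟨(x.num.toNat, x.den), ⟨⟨⟨by omega, x.den_pos, ?_⟩, ?_⟩, ?_⟩, ?_⟩
      · zify; rw [hnum]; exact h
      · have := x.reduced
        rwa [← hnum, Int.natAbs_natCast] at this
      · zify
        rw [hnum]
        simpa using (Rat.le_iff x 1).1 h1
      · have : (x.num.toNat : ℚ) = x.num := by exact_mod_cast hnum
        simp only [this]
        exact x.num_div_den
    · rintro (rfl | ⟨⟨a, b⟩, ⟨⟨⟨ha, hb, hab⟩, hco⟩, hle⟩, rfl⟩)
      · simp
      · have hnum := Rat.num_div_eq_of_coprime (a := a) (b := b) (by exact_mod_cast hb) hco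
        have hden := Rat.den_div_eq_of_coprime (a := a) (b := b) (by exact_mod_cast hb) hco
        push_cast at hnum hden
        simp only at *
        refine ⟨by positivity, div_le_one_of_le₀ (by exact_mod_cast hle) (by positivity), ?_⟩
        rw [hnum, hden]
        exact_mod_cast hab
  rw [hset, Set.ncard_coe_finset, card_insert_of_notMem, card_image_of_injOn hinj]
  simp only [mem_image, not_exists, not_and, coprimeHyperbolaPairs, mem_filter, mem_hyperbolaPairs]
  rintro ⟨a, b⟩ h
  have h1 : a ≠ 0 := h.1.1.1.ne'
  have h2 : b ≠ 0 := h.1.1.2.1.ne'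
  simp [h1, h2]

theorem hasSum_moebius_div_sq :
    HasSum (fun n : ℕ => (μ n : ℝ) / (n : ℝ) ^ 2) (6 / Real.pi ^ 2) := by
  have h2 : 1 < (2 : ℂ).re := by simp
  have hz := LSeries_zeta_mul_Lseries_moebius h2
  rw [LSeries_zeta_eq_riemannZeta h2, riemannZeta_two] at hz
  have hs := (LSeriesSummable_moebius_iff.2 h2).LSeriesHasSum
  rw [eq_inv_of_mul_eq_one_right hz, inv_div, LSeriesHasSum] at hs
  rw [← Complex.hasSum_ofReal]
  convert! hs using 1
  · ext n
    rcases eq_or_ne n 0 with rfl | hn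
    · simp
    · simp [LSeries.term_of_ne_zero hn]
  · simp

theorem summable_log_div_sq : Summable fun n : ℕ => Real.log n / (n : ℝ) ^ 2 := by
  have h : Summable fun n : ℕ => 2 * (1 / (n : ℝ) ^ (3 / 2 : ℝ)) :=
    (Real.summable_one_div_nat_rpow.2 (by norm_num)).mul_left 2
  refine h.of_nonneg_of_le (fun n => by positivity) fun n => ?_
  rcases Nat.eq_zero_or_pos n with rfl | hn
  · simp
  have hn' : (0 : ℝ) < n := by exact_mod_cast hn
  have hlog := Real.log_le_rpow_div hn'.le (ε := 1 / 2) (by norm_num)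
  have hpow : (n : ℝ) ^ 2 = (n : ℝ) ^ (3 / 2 : ℝ) * (n : ℝ) ^ (1 / 2 : ℝ) := by
    rw [← Real.rpow_add hn', ← Real.rpow_natCast]
    norm_num
  rw [hpow, div_le_iff₀ (by positivity)]
  have h0 : (n : ℝ) ^ (3 / 2 : ℝ) ≠ 0 := by positivity
  field_simp
  linarith

theorem summable_two_mul_log_add_two_div_sq :
    Summable fun d : ℕ => (2 * Real.log d + 2) / (d : ℝ) ^ 2 := by
  refine ((summable_log_div_sq.mul_left 2).add
    ((Real.summable_one_div_nat_pow.2 one_lt_two).mul_left 2)).congr fun d => ?_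
  ring

theorem abs_card_hyperbolaPairs_div_sq_sub_le {m d : ℕ} (hm : 1 ≤ m) (hd : 1 ≤ d) :
    |(#(hyperbolaPairs (m / d ^ 2)) : ℝ) - m * Real.log m / (d : ℝ) ^ 2| ≤
      m * ((2 * Real.log d + 2) / (d : ℝ) ^ 2) := by
  have hm' : (1 : ℝ) ≤ m := by exact_mod_cast hm
  have hd' : (1 : ℝ) ≤ d := by exact_mod_cast hd
  have hlogd := Real.log_nonneg hd'
  have hlogm := Real.log_nonneg hm'
  have hfloor : m / d ^ 2 = ⌊(m : ℝ) / (d : ℝ) ^ 2⌋₊ := by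
    rw [← Nat.cast_pow, Nat.floor_div_eq_div]
  rcases le_or_gt (d ^ 2) m with h | h
  · have hx : 1 ≤ (m : ℝ) / (d : ℝ) ^ 2 := by
      rw [one_le_div (by positivity)]
      exact_mod_cast h
    have key := abs_card_hyperbolaPairs_floor_sub_le hx
    rw [← hfloor, Real.log_div (by positivity) (by positivity), Real.log_pow] at key
    calc |(#(hyperbolaPairs (m / d ^ 2)) : ℝ) - m * Real.log m / (d : ℝ) ^ 2| =
            |((#(hyperbolaPairs (m / d ^ 2)) : ℝ) - m / (d : ℝ) ^ 2 *
              (Real.log m - (2 : ℕ) * Real.log d)) +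
            -(m / (d : ℝ) ^ 2 * (2 * Real.log d))| := by
          congr 1
          push_cast
          ring
      _ ≤ 2 * (m / (d : ℝ) ^ 2) + m / (d : ℝ) ^ 2 * (2 * Real.log d) := by
          refine (abs_add_le _ _).trans (add_le_add key ?_)
          rw [abs_neg, abs_of_nonneg (by positivity)]
      _ = _ := by ring
  · have hlog : Real.log m ≤ 2 * Real.log d := by
      have := Real.log_le_log (by positivity) (show (m : ℝ) ≤ (d : ℝ) ^ 2 by exact_mod_cast h.le)
      rwa [Real.log_pow, Nat.cast_ofNat] at this
    rw [Nat.div_eq_of_lt h, show hyperbolaPairs 0 = ∅ from rfl, card_empty, Nat.cast_zero, zero_sub,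
      abs_neg, abs_of_nonneg (by positivity), mul_div_assoc]
    gcongr
    linarith

theorem abs_card_coprimeHyperbolaPairs_sub_le {m : ℕ} (hm : 1 ≤ m) :
    |(#(coprimeHyperbolaPairs m) : ℝ) - 6 / Real.pi ^ 2 * m * Real.log m| ≤
      (∑' d : ℕ, (2 * Real.log d + 2) / (d : ℝ) ^ 2) * (m : ℝ) := by
  have hC : HasSum (fun d : ℕ => (μ d : ℝ) * #(hyperbolaPairs (m / d ^ 2)))
      (#(coprimeHyperbolaPairs m) : ℝ) := by
    have h : (#(coprimeHyperbolaPairs m) : ℝ) =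
        ∑ d ∈ Icc 1 m, (μ d : ℝ) * #(hyperbolaPairs (m / d ^ 2)) := by
      exact_mod_cast card_coprimeHyperbolaPairs m
    rw [h]
    refine hasSum_sum_of_ne_finset_zero fun d hd => ?_
    rcases Nat.eq_zero_or_pos d with rfl | hd0
    · simp
    · have hlt : m < d := by
        by_contra hle
        exact hd (mem_Icc.2 ⟨hd0, not_lt.1 hle⟩)
      rw [Nat.div_eq_of_lt (by nlinarith), show hyperbolaPairs 0 = ∅ from rfl]
      simp
  have hdiff := hC.sub (hasSum_moebius_div_sq.mul_right (m * Real.log m))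
  have hbound := summable_two_mul_log_add_two_div_sq.hasSum.mul_left (m : ℝ)
  rw [mul_comm (∑' _, _) (m : ℝ), mul_assoc, ← Real.norm_eq_abs]
  refine hdiff.norm_le_of_bounded hbound fun d => ?_
  rcases Nat.eq_zero_or_pos d with rfl | hd
  · simp
  rw [show (μ d : ℝ) * #(hyperbolaPairs (m / d ^ 2)) - μ d / (d : ℝ) ^ 2 * (m * Real.log m) =
    μ d * (#(hyperbolaPairs (m / d ^ 2)) - m * Real.log m / (d : ℝ) ^ 2) by ring, norm_mul,
    Real.norm_eq_abs, Real.norm_eq_abs]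
  have hμ : |(μ d : ℝ)| ≤ 1 := by exact_mod_cast abs_moebius_le_one (n := d)
  exact (mul_le_of_le_one_left (abs_nonneg _) hμ).trans
    (abs_card_hyperbolaPairs_div_sq_sub_le hm hd)

end

/-- There is a constant `K > 0` such that for every integer `m ≥ 2`,
`||F_{1/m}| - (3/π²) m ln m| ≤ K m`; that is, `|F_{1/m}| = (m/(2 ζ(2))) ln m + O(m)`,
so the cardinality of `F_{1/m}` grows log-linearly. -/
theorem card_fordFracs_loglinear :
    ∃ K : ℝ, 0 < K ∧ ∀ m : ℕ, 2 ≤ m →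
      |((fordFracs m).ncard : ℝ) - (3 / Real.pi ^ 2) * m * Real.log m| ≤ K * m := by
  set S := ∑' d : ℕ, (2 * Real.log d + 2) / (d : ℝ) ^ 2
  have hS : 0 ≤ S := tsum_nonneg fun d => by positivity
  refine ⟨S / 2 + 3 / 2, by positivity, fun m hm => ?_⟩
  have hm1 : 1 ≤ m := by omega
  have hm' : (1 : ℝ) ≤ m := by exact_mod_cast hm1
  have hcard : 2 * ((fordFracs m).ncard : ℝ) = (coprimeHyperbolaPairs m).card + 3 := by
    have h := card_coprimeHyperbolaPairs_add_one hm1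
    have h' := ncard_fordFracs m
    exact_mod_cast (by omega : 2 * (fordFracs m).ncard = (coprimeHyperbolaPairs m).card + 3)
  have key := abs_le.1 (abs_card_coprimeHyperbolaPairs_sub_le hm1)
  have hpi : 6 / Real.pi ^ 2 * m * Real.log m = 2 * (3 / Real.pi ^ 2 * m * Real.log m) := by ring
  rw [hpi] at key
  rw [abs_le]
  constructor <;> linarith [key.1, key.2]
end

section
/- Let p₁/q₁ and p₂/q₂ be two distinct fractions in lowest terms with q₁, q₂ positive integers. Then the squared Euclidean distance between the centers of their Ford circles satisfies (p₁/q₁ − p₂/q₂)² + (1/(2q₁²) − 1/(2q₂²))² ≥ (1/(2q₁²) + 1/(2q₂²))², with equality if and only if |p₂q₁ − p₁q₂| = 1; that is, two Ford circles never overlap, and they are tangent exactly when |p₂q₁ − p₁q₂| = 1. -/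
/-- The squared distance between the centers of the circles of radii `1 / (2 * b ^ 2)` and
`1 / (2 * d ^ 2)` resting on the real line at `a / b` and `c / d`, minus the square of the sum of
the radii. -/
theorem ford_circles_dist_sq_sub_radii_sq {K : Type*} [Field K] [CharZero K] (a c : K) {b d : K}
    (hb : b ≠ 0) (hd : d ≠ 0) :
    (a / b - c / d) ^ 2 + (1 / (2 * b ^ 2) - 1 / (2 * d ^ 2)) ^ 2 -
        (1 / (2 * b ^ 2) + 1 / (2 * d ^ 2)) ^ 2 =
      ((c * b - a * d) ^ 2 - 1) / (b * d) ^ 2 := by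
  field_simp
  ring

/-- Ford circles never overlap, and are tangent exactly when `|p₂ q₁ - p₁ q₂| = 1`:
for distinct reduced fractions `p₁/q₁ ≠ p₂/q₂`, the squared distance between the centers
of their Ford circles is at least the square of the sum of the radii, with equality
if and only if `|p₂ q₁ - p₁ q₂| = 1`. -/
theorem ford_circles_dont_overlap (p₁ q₁ p₂ q₂ : ℤ) (hq₁ : 0 < q₁) (hq₂ : 0 < q₂)
    (hcop₁ : IsCoprime p₁ q₁) (hcop₂ : IsCoprime p₂ q₂)
    (hne : (p₁ : ℚ) / q₁ ≠ (p₂ : ℚ) / q₂) :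
    ((p₁ : ℝ) / q₁ - p₂ / q₂) ^ 2 + (1 / (2 * (q₁ : ℝ) ^ 2) - 1 / (2 * (q₂ : ℝ) ^ 2)) ^ 2 ≥
        (1 / (2 * (q₁ : ℝ) ^ 2) + 1 / (2 * (q₂ : ℝ) ^ 2)) ^ 2 ∧
      (((p₁ : ℝ) / q₁ - p₂ / q₂) ^ 2 +
            (1 / (2 * (q₁ : ℝ) ^ 2) - 1 / (2 * (q₂ : ℝ) ^ 2)) ^ 2 =
          (1 / (2 * (q₁ : ℝ) ^ 2) + 1 / (2 * (q₂ : ℝ) ^ 2)) ^ 2 ↔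
        |p₂ * q₁ - p₁ * q₂| = 1) := by
  have hb : (q₁ : ℝ) ≠ 0 := by exact_mod_cast hq₁.ne'
  have hd : (q₂ : ℝ) ≠ 0 := by exact_mod_cast hq₂.ne'
  have key := ford_circles_dist_sq_sub_radii_sq (p₁ : ℝ) p₂ hb hd
  have hdet : p₂ * q₁ - p₁ * q₂ ≠ 0 := by
    intro h
    apply hne
    rw [div_eq_div_iff (by exact_mod_cast hq₁.ne') (by exact_mod_cast hq₂.ne')]
    exact_mod_cast (sub_eq_zero.mp h).symm
  constructor
  · have hdet_sq : (1 : ℝ) ≤ ((p₂ : ℝ) * q₁ - p₁ * q₂) ^ 2 := by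
      exact_mod_cast Int.add_one_le_iff.mpr (sq_pos_of_ne_zero hdet)
    rw [ge_iff_le, ← sub_nonneg, key]
    exact div_nonneg (sub_nonneg.mpr hdet_sq) (sq_nonneg _)
  · rw [← sub_eq_zero, key, div_eq_zero_iff, or_iff_left (pow_ne_zero 2 (mul_ne_zero hb hd)),
      sub_eq_zero, sq_eq_one_iff, abs_eq zero_le_one]
    norm_cast
end
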